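/- Let Γ be a finite connected multigraph with genus function g : Verts(Γ) → ℕ such that g(Γ) + |Verts(Γ)| ≥ 2, and define φ_IBD ∈ ℝ^{Verts(Γ)} by φ_IBD(v) := (g(Γ) + |Verts(Γ)|)/(2(g(Γ) + |Verts(Γ)|) − 2) · (2g(v) + val_Γ(v)) − 1, where val_Γ(v) is the valence of v in Γ (with loops at v counted twice). Then φ_IBD ∈ V^{g(Γ)}(Γ), and σ_IBD = stab_{Γ,φ_IBD}: for every connected spanning subgraph G ⊆ Γ, the integral break divisors for G are exactly the φ_IBD-semistable elements of S^{g(Γ)}_Γ(G). -/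

import Mathlib

open Finset

variable {V E : Type} [Fintype V] [Fintype E] [DecidableEq V] [DecidableEq E]

/-- The unordered pair of endpoints of an edge. -/
def eSym (ends : E → V × V) (e : E) : Sym2 V := s((ends e).1, (ends e).2)

/-- Reachability in the spanning subgraph with edge set `A`. -/
def Linked (ends : E → V × V) (A : Finset E) : V → V → Prop :=
  Relation.ReflTransGen (fun v w => ∃ e ∈ A, eSym ends e = s(v, w))

/-- The spanning subgraph with edge set `A` is connected. -/
def Conn (ends : E → V × V) (A : Finset E) : Prop :=
  Nonempty V ∧ ∀ v w : V, Linked ends A v w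

/-- The induced subgraph on the vertex set `W` is connected. -/
def ConnOn (ends : E → V × V) (W : Finset V) : Prop :=
  W.Nonempty ∧ ∀ v ∈ W, ∀ w ∈ W,
    Relation.ReflTransGen (fun a b => a ∈ W ∧ b ∈ W ∧ ∃ e : E, eSym ends e = s(a, b)) v w

/-- A spanning tree: a connected spanning subgraph with `|V| - 1` edges. -/
def IsSpanningTree (ends : E → V × V) (A : Finset E) : Prop :=
  Conn ends A ∧ A.card + 1 = Fintype.card V

/-- The complexity of the spanning subgraph `A`: the number of its spanning trees. -/
noncomputable def complexity (ends : E → V × V) (A : Finset E) : ℕ :=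
  Nat.card {T : Finset E // T ⊆ A ∧ IsSpanningTree ends T}

/-- `n(G)`: the number of edges of `Γ` missing from the spanning subgraph `G`. -/
def nG (A : Finset E) : ℕ := (Finset.univ \ A).card

/-- The space of multidegrees of total degree `d` at `A`. -/
def Sdeg (d : ℤ) (A : Finset E) : Set (V → ℤ) :=
  {x | ∑ v, x v = d - (nG A : ℤ)}

/-- The twister at vertex `v` of the spanning subgraph with edge set `A`. -/
def twVec (ends : E → V × V) (A : Finset E) (v : V) : V → ℤ := fun w =>
  if w = v then
    -((A.filter (fun e => v ∈ eSym ends e ∧ ¬(eSym ends e).IsDiag)).card : ℤ)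
  else ((A.filter (fun e => eSym ends e = s(v, w))).card : ℤ)

/-- The twister (chip-firing) group of the spanning subgraph with edge set `A`. -/
def twGroup (ends : E → V × V) (A : Finset E) : AddSubgroup (V → ℤ) :=
  AddSubgroup.closure (Set.range (twVec ends A))

/-- The standard basis vector at `v`. -/
def stdVec (v : V) : V → ℤ := fun w => if w = v then 1 else 0

/-- A degree-`d` assignment: supported on connected spanning subgraphs, with the
prescribed total degree. -/
def IsAssignment (ends : E → V × V) (d : ℤ) (σ : Finset E → Set (V → ℤ)) : Prop :=
  ∀ A : Finset E, ∀ x ∈ σ A, Conn ends A ∧ x ∈ Sdeg d A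

/-- Condition (1), chip-adding. -/
def ChipAdding (ends : E → V × V) (σ : Finset E → Set (V → ℤ)) : Prop :=
  ∀ A : Finset E, ∀ x ∈ σ A, ∀ e ∉ A, ∀ v ∈ eSym ends e, x + stdVec v ∈ σ (insert e A)

/-- `S` is a minimal complete set of representatives for the action of the twister group
of `A` on the multidegree space `S^d(A)`. -/
def IsRepSet (ends : E → V × V) (d : ℤ) (A : Finset E) (S : Set (V → ℤ)) : Prop :=
  S ⊆ Sdeg d A ∧ ∀ x ∈ Sdeg (E := E) d A, ∃! y, y ∈ S ∧ x - y ∈ twGroup ends A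

/-- A degree-`d` stability assignment. -/
def IsStabilityAssignment (ends : E → V × V) (d : ℤ) (σ : Finset E → Set (V → ℤ)) : Prop :=
  IsAssignment ends d σ ∧ ChipAdding ends σ ∧
    ∀ A : Finset E, Conn ends A → IsRepSet ends d A (σ A)

/-- Vertices of the subdivision `Γ̃_m`: original vertices plus, for each edge `e`,
`m e` exceptional vertices. -/
abbrev SubV (V E : Type) (m : E → ℕ) : Type := V ⊕ (Σ e : E, Fin (m e))

/-- Edges of the subdivision `Γ̃_m`: each edge `e` is replaced by a chain of `m e + 1` edges. -/
abbrev SubE (E : Type) (m : E → ℕ) : Type := Σ e : E, Fin (m e + 1)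

/-- The `i`-th vertex along the chain replacing the edge `e` in the subdivision. -/
def subNode (ends : E → V × V) (m : E → ℕ) (e : E) (i : ℕ) : SubV V E m :=
  if h0 : i = 0 then Sum.inl (ends e).1
  else if h : i ≤ m e then Sum.inr ⟨e, ⟨i - 1, by omega⟩⟩
  else Sum.inl (ends e).2

/-- The endpoints of the edges of the subdivision `Γ̃_m`. -/
def subEnds (ends : E → V × V) (m : E → ℕ) : SubE E m → SubV V E m × SubV V E m :=
  fun p => (subNode ends m p.1 p.2.val, subNode ends m p.1 (p.2.val + 1))

/-- The lift of the multidegree `x` on `(A, Γ)`: extend by zero and add one chip on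
the exceptional vertex `t e` of every removed edge `e ∉ A`. -/
def liftOf (m : E → ℕ) (A : Finset E) (x : V → ℤ) (t : E → ℕ) : SubV V E m → ℤ :=
  Sum.elim x fun p => if p.1 ∉ A ∧ (p.2 : ℕ) = t p.1 then 1 else 0

/-- The lift `σ̃_m` of an assignment `σ`: all lifts of all elements of `σ`. -/
def liftSet (m : E → ℕ) (σ : Finset E → Set (V → ℤ)) : Set (SubV V E m → ℤ) :=
  {y | ∃ (A : Finset E) (x : V → ℤ) (t : E → ℕ),
    x ∈ σ A ∧ (∀ e ∉ A, t e < m e) ∧ y = liftOf m A x t}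

/-- Edges with both endpoints in `W` (the edges of the induced subgraph `Γ(W)`). -/
def inE (ends : E → V × V) (W : Finset V) : Finset E :=
  Finset.univ.filter fun e => (ends e).1 ∈ W ∧ (ends e).2 ∈ W

/-- Edges with one endpoint in `W` and the other in `Wᶜ`. -/
def cutE (ends : E → V × V) (W : Finset V) : Finset E :=
  Finset.univ.filter fun e =>
    ((ends e).1 ∈ W ∧ (ends e).2 ∉ W) ∨ ((ends e).1 ∉ W ∧ (ends e).2 ∈ W)

/-- `φ`-semistability of the multidegree `x` on the spanning subgraph `A`. -/
def PhiSemistable (ends : E → V × V) (φ : V → ℝ) (A : Finset E) (x : V → ℤ) : Prop :=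
  ∀ W : Finset V, W.Nonempty → W ≠ Finset.univ →
    |(∑ v ∈ W, ((x v : ℝ) - φ v)) + (((Finset.univ \ A) ∩ inE ends W).card : ℝ) +
        (((Finset.univ \ A) ∩ cutE ends W).card : ℝ) / 2| ≤
      ((A ∩ cutE ends W).card : ℝ) / 2

/-- `φ`-stability of the multidegree `x` on the spanning subgraph `A`. -/
def PhiStable (ends : E → V × V) (φ : V → ℝ) (A : Finset E) (x : V → ℤ) : Prop :=
  ∀ W : Finset V, W.Nonempty → W ≠ Finset.univ →
    |(∑ v ∈ W, ((x v : ℝ) - φ v)) + (((Finset.univ \ A) ∩ inE ends W).card : ℝ) +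
        (((Finset.univ \ A) ∩ cutE ends W).card : ℝ) / 2| <
      ((A ∩ cutE ends W).card : ℝ) / 2

/-- Nondegeneracy of a numerical polarization `φ`. -/
def Nondegenerate (ends : E → V × V) (d : ℤ) (φ : V → ℝ) : Prop :=
  ∀ A : Finset E, ∀ x ∈ Sdeg d A, PhiSemistable ends φ A x → PhiStable ends φ A x

/-- The assignment `stab_{Γ,φ}` associated with a numerical polarization `φ`. -/
def stabAssign (ends : E → V × V) (d : ℤ) (φ : V → ℝ) : Finset E → Set (V → ℤ) :=
  fun A => {x | Conn ends A ∧ x ∈ Sdeg d A ∧ PhiSemistable ends φ A x}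

/-- The valence of the vertex `v` (loops counted twice). -/
def valence (ends : E → V × V) (v : V) : ℕ :=
  ∑ e : E, ((if (ends e).1 = v then 1 else 0) + (if (ends e).2 = v then 1 else 0))

/-- `x` is an integral break divisor for the connected spanning subgraph `A`. -/
def isIBD (ends : E → V × V) (gen : V → ℕ) (A : Finset E) (x : V → ℤ) : Prop :=
  ∃ T : Finset E, T ⊆ A ∧ IsSpanningTree ends T ∧
    ∃ t : E → V, (∀ e ∈ A \ T, t e ∈ eSym ends e) ∧
      x = fun v => (gen v : ℤ) + (((A \ T).filter fun e => t e = v).card : ℤ)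

/-- The multidegree `(a, b)` on a two-vertex graph with first vertex `v₁`. -/
def pairFn (v₁ : V) (a b : ℤ) : V → ℤ := fun w => if w = v₁ then a else b

/-- The genus `g(Γ) = b₁(Γ) + Σ_v gen v` of a genus-labelled multigraph. -/
def gGamma (E : Type) [Fintype E] {V : Type} [Fintype V] (gen : V → ℕ) : ℤ :=
  (Fintype.card E : ℤ) - (Fintype.card V : ℤ) + 1 + ∑ v : V, (gen v : ℤ)

/-- The numerical polarization `φ_IBD` inducing integral break divisors:
`φ_IBD(v) = (g(Γ)+|V|)/(2(g(Γ)+|V|)−2) · (2 gen v + val_Γ(v)) − 1`. -/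
noncomputable def phiIBD (ends : E → V × V) (gen : V → ℕ) : V → ℝ := fun v =>
  ((gGamma E gen : ℝ) + (Fintype.card V : ℝ)) /
      (2 * ((gGamma E gen : ℝ) + (Fintype.card V : ℝ)) - 2) *
      (2 * (gen v : ℝ) + (valence ends v : ℝ)) - 1

lemma Conn.exists_mem_cutE {ends : E → V × V} {A : Finset E} (hA : Conn ends A)
    {W : Finset V} (hW : W.Nonempty) (hW' : W ≠ univ) : ∃ e ∈ A, e ∈ cutE ends W := by
  obtain ⟨a, ha⟩ := hW
  obtain ⟨b, hb⟩ : ∃ b, b ∉ W := by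
    by_contra! h
    exact hW' (eq_univ_iff_forall.2 h)
  by_contra! hcut
  refine hb ?_
  clear hb hW'
  have hab := hA.2 a b
  unfold Linked at hab
  induction hab with
  | refl => exact ha
  | tail _ hstep ih =>
    obtain ⟨e, he, hs⟩ := hstep
    have := hcut e he
    simp only [cutE, mem_filter, mem_univ, true_and] at this
    simp only [eSym, Sym2.eq_iff] at hs
    rcases hs with ⟨h1, h2⟩ | ⟨h1, h2⟩ <;> rw [h1, h2] at this <;> tauto

/-- A connected graph has at least as many edges not contained in `W` as vertices outside `W`. -/
lemma Conn.card_le_card_inE_add {ends : E → V × V} {T : Finset E} (hT : Conn ends T)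
    {W : Finset V} (hW : W.Nonempty) :
    (T ∩ inE ends W).card + Fintype.card V ≤ T.card + W.card := by
  induction hn : Wᶜ.card using Nat.strong_induction_on generalizing W with
  | _ n ih =>
    by_cases hu : W = univ
    · subst hu
      simpa using card_le_card (inter_subset_left (s₁ := T) (s₂ := inE ends univ))
    obtain ⟨e, he, hcut⟩ := hT.exists_mem_cutE hW hu
    obtain ⟨w, hw, hin, hnot⟩ :
        ∃ w ∉ W, e ∈ inE ends (insert w W) ∧ e ∉ inE ends W := by
      simp only [cutE, inE, mem_filter, mem_univ, true_and, mem_insert] at hcut ⊢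
      rcases hcut with h | h
      · exact ⟨_, h.2, by tauto, by tauto⟩
      · exact ⟨_, h.1, by tauto, by tauto⟩
    have hsub : insert e (T ∩ inE ends W) ⊆ T ∩ inE ends (insert w W) := by
      intro f hf
      rcases mem_insert.1 hf with rfl | hf
      · exact mem_inter.2 ⟨he, hin⟩
      · simp only [inE, mem_inter, mem_filter, mem_univ, true_and, mem_insert] at hf ⊢
        tauto
    have h1 := card_le_card hsub
    rw [card_insert_of_notMem (by simp [hnot])] at h1
    have hlt : (insert w W)ᶜ.card < n := by
      rw [← hn]
      refine card_lt_card ⟨compl_subset_compl.2 (subset_insert _ _), fun h => ?_⟩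
      simpa using h (mem_compl.2 hw)
    have h2 := ih _ hlt (insert_nonempty w W) rfl
    rw [card_insert_of_notMem hw] at h2
    omega

lemma mem_eSym_iff {ends : E → V × V} {e : E} {v : V} :
    v ∈ eSym ends e ↔ v = (ends e).1 ∨ v = (ends e).2 := Sym2.mem_iff

/-- Every break divisor has enough chips on each nonempty set of vertices. -/
lemma isIBD.card_inE_lt {ends : E → V × V} {gen : V → ℕ} {A : Finset E} {x : V → ℤ}
    (hx : isIBD ends gen A x) {W : Finset V} (hW : W.Nonempty) :
    ((A ∩ inE ends W).card : ℤ) + 1 ≤ ∑ v ∈ W, (x v - gen v) + W.card := by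
  obtain ⟨T, hTA, ⟨hT, hcard⟩, t, ht, rfl⟩ := hx
  have h1 := hT.card_le_card_inE_add hW
  have h2 : ((A ∩ inE ends W) \ (T ∩ inE ends W)).card
      ≤ ∑ v ∈ W, ((A \ T).filter fun e => t e = v).card := by
    rw [sum_card_fiberwise_eq_card_filter]
    refine card_le_card fun e he => ?_
    simp only [inE, mem_sdiff, mem_inter, mem_filter, mem_univ, true_and] at he ⊢
    have heAT : e ∈ A ∧ e ∉ T := by tauto
    refine ⟨heAT, ?_⟩
    rcases mem_eSym_iff.1 (ht e (mem_sdiff.2 heAT)) with h | h <;> rw [h] <;> tauto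
  rw [card_sdiff_of_subset (inter_subset_inter_right hTA)] at h2
  simp only [add_sub_cancel_left]
  rw [← Nat.cast_sum]
  omega

lemma isIBD.mem_Sdeg {ends : E → V × V} {gen : V → ℕ} {A : Finset E} {x : V → ℤ}
    (hx : isIBD ends gen A x) : x ∈ Sdeg (gGamma E gen) A := by
  obtain ⟨T, hTA, ⟨hT, hcard⟩, t, ht, rfl⟩ := hx
  have h := card_eq_sum_card_fiberwise (f := t) (s := A \ T) (t := univ) (by simp)
  have h1 := card_sdiff_add_card_eq_card hTA
  have h2 := card_sdiff_add_card_eq_card (subset_univ A)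
  rw [card_univ] at h2
  simp only [Sdeg, Set.mem_ofPred_eq, sum_add_distrib, gGamma, nG]
  rw [← Nat.cast_sum univ (fun v => ((A \ T).filter fun e => t e = v).card), ← h]
  omega

/-- Hakimi's theorem: a degree sequence is the indegree sequence of an orientation as soon as
it dominates the number of edges inside every nonempty set of vertices. -/
lemma exists_orientation [Nonempty V] {ends : E → V × V} {A : Finset E} {D : V → ℕ}
    (hD : ∀ W : Finset V, W.Nonempty → (A ∩ inE ends W).card ≤ ∑ v ∈ W, D v)
    (hsum : ∑ v, D v = A.card) :
    ∃ t : E → V, (∀ e ∈ A, t e ∈ eSym ends e) ∧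
      ∀ v, (A.filter fun e => t e = v).card = D v := by
  let slots : A → Finset (Σ v : V, Fin (D v)) := fun e =>
    ({(ends e).1, (ends e).2} : Finset V).sigma fun _ => univ
  have hall : ∀ S : Finset A, S.card ≤ (S.biUnion slots).card := by
    intro S
    rcases S.eq_empty_or_nonempty with rfl | hS
    · simp
    set W : Finset V := S.biUnion fun e => {(ends e).1, (ends e).2} with hWdef
    have hW : W.Nonempty := by
      obtain ⟨e, he⟩ := hS
      exact ⟨(ends e).1, mem_biUnion.2 ⟨e, he, by simp⟩⟩
    have h1 : S.biUnion slots = W.sigma fun _ => univ := by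
      ext p
      simp [slots, hWdef]
    rw [h1, card_sigma]
    simp only [card_univ, Fintype.card_fin]
    refine le_trans ?_ (hD W hW)
    rw [← card_map (Function.Embedding.subtype _)]
    refine card_le_card fun e he => ?_
    obtain ⟨f, hf, rfl⟩ := mem_map.1 he
    simp only [inE, mem_inter, mem_filter, mem_univ, true_and]
    exact ⟨f.2, mem_biUnion.2 ⟨f, hf, by simp⟩, mem_biUnion.2 ⟨f, hf, by simp⟩⟩
  obtain ⟨F, hFinj, hF⟩ := (all_card_le_biUnion_card_iff_exists_injective slots).1 hall
  let t : E → V := fun e => if h : e ∈ A then (F ⟨e, h⟩).1 else Classical.arbitrary V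
  have ht : ∀ e : A, t e = (F e).1 := fun e => by simp [t]
  have hle : ∀ v, (A.filter fun e => t e = v).card ≤ D v := by
    intro v
    have hc : (univ.filter fun p : Σ v : V, Fin (D v) => p.1 = v).card = D v := by
      have : (univ.filter fun p : Σ v : V, Fin (D v) => p.1 = v)
          = ({v} : Finset V).sigma fun _ => univ := by
        ext p
        simp
      rw [this, card_sigma]
      simp
    rw [← hc]
    refine card_le_card_of_forall_subsingleton (fun e p => ∃ h : e ∈ A, F ⟨e, h⟩ = p) ?_ ?_
    · intro e he
      obtain ⟨heA, hev⟩ := mem_filter.1 he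
      exact ⟨F ⟨e, heA⟩, by simpa [← ht ⟨e, heA⟩] using hev, heA, rfl⟩
    · rintro p - e ⟨-, he, hep⟩ f ⟨-, hf, hfp⟩
      exact congrArg Subtype.val (hFinj (hep.trans hfp.symm))
  refine ⟨t, fun e he => ?_, fun v => ?_⟩
  · have := hF ⟨e, he⟩
    rw [ht ⟨e, he⟩, mem_eSym_iff]
    simpa [slots] using this
  · have h := card_eq_sum_card_fiberwise (f := t) (s := A) (t := univ) (by simp)
    rw [← hsum] at h
    exact (sum_eq_sum_iff_of_le fun v _ => hle v).1 h.symm v (mem_univ v)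

lemma Linked.mono {ends : E → V × V} {A B : Finset E} (h : A ⊆ B) {v w : V}
    (hl : Linked ends A v w) : Linked ends B v w :=
  Relation.ReflTransGen.mono (fun _ _ ⟨e, he, hs⟩ => ⟨e, h he, hs⟩) _ _ hl

lemma Linked.symm {ends : E → V × V} {A : Finset E} {v w : V}
    (hl : Linked ends A v w) : Linked ends A w v :=
  have : Std.Symm fun v w => ∃ e ∈ A, eSym ends e = s(v, w) :=
    ⟨fun _ _ ⟨e, he, hs⟩ => ⟨e, he, hs.trans Sym2.eq_swap⟩⟩
  Relation.ReflTransGen.stdSymm.symm _ _ hl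

/-- If every nonempty vertex set avoiding `q` is entered by an oriented edge, then there is a
spanning arborescence rooted at `q`. -/
lemma exists_arborescence {ends : E → V × V} {A : Finset E} {t : E → V} {q : V}
    (ht : ∀ e ∈ A, t e ∈ eSym ends e)
    (hcut : ∀ W : Finset V, W.Nonempty → q ∉ W → ∃ e ∈ A, t e ∈ W ∧ e ∉ inE ends W) :
    ∃ T ⊆ A, Conn ends T ∧
      ∀ v, (T.filter fun e => t e = v).card = if v = q then 0 else 1 := by
  have grow : ∀ n, n < Fintype.card V → ∃ R : Finset V, ∃ T ⊆ A, R.card = n + 1 ∧ q ∈ R ∧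
      (∀ v ∈ R, Linked ends T q v) ∧
      ∀ v, (T.filter fun e => t e = v).card = if v ∈ R ∧ v ≠ q then 1 else 0 := by
    intro n
    induction n with
    | zero =>
      intro _
      refine ⟨{q}, ∅, empty_subset _, by simp, by simp, ?_, by simp⟩
      intro v hv
      rw [mem_singleton.1 hv]
      exact Relation.ReflTransGen.refl
    | succ n ih =>
      intro hn
      obtain ⟨R, T, hTA, hRc, hqR, hlink, hdeg⟩ := ih (by omega)
      have hne : Rᶜ.Nonempty := by
        rw [← card_pos, card_compl]
        omega
      obtain ⟨e, he, hte, hein⟩ := hcut Rᶜ hne (by simpa using hqR)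
      have hteR : t e ∉ R := mem_compl.1 hte
      have heT : e ∉ T := by
        intro h
        have := hdeg (t e)
        rw [if_neg (by tauto), card_eq_zero] at this
        exact notMem_empty e (this ▸ mem_filter.2 ⟨h, rfl⟩)
      obtain ⟨u, hu, hsym⟩ : ∃ u ∈ R, eSym ends e = s(u, t e) := by
        simp only [inE, mem_filter, mem_univ, true_and, mem_compl] at hein
        rcases mem_eSym_iff.1 (ht e he) with h | h
        · refine ⟨(ends e).2, ?_, by rw [h]; exact Sym2.eq_swap⟩
          rw [h] at hteR
          tauto
        · refine ⟨(ends e).1, ?_, by rw [h]; rfl⟩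
          rw [h] at hteR
          tauto
      refine ⟨insert (t e) R, insert e T, insert_subset he hTA, ?_, mem_insert_of_mem hqR, ?_, ?_⟩
      · rw [card_insert_of_notMem hteR, hRc]
      · intro v hv
        rcases mem_insert.1 hv with rfl | hv
        · exact ((hlink u hu).mono (subset_insert e T)).tail ⟨e, mem_insert_self _ _, hsym⟩
        · exact (hlink v hv).mono (subset_insert e T)
      · intro v
        have hq : t e ≠ q := fun h => hteR (h ▸ hqR)
        rw [filter_insert]
        split_ifs with h1 h2 h2
        · rw [card_insert_of_notMem (by simp [heT]), hdeg, if_neg]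
          rw [← h1]
          tauto
        · exact absurd ⟨by simp [h1], h1 ▸ hq⟩ h2
        · rw [hdeg, if_pos]
          have := h2.1
          rw [mem_insert] at this
          exact ⟨this.resolve_left fun h => h1 h.symm, h2.2⟩
        · rw [hdeg, if_neg]
          exact fun h => h2 ⟨mem_insert_of_mem h.1, h.2⟩
  have hpos : 0 < Fintype.card V := Fintype.card_pos_iff.2 ⟨q⟩
  obtain ⟨R, T, hTA, hRc, -, hlink, hdeg⟩ := grow (Fintype.card V - 1) (by omega)
  have hR : R = univ := by
    rw [← card_eq_iff_eq_univ]
    omega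
  subst hR
  refine ⟨T, hTA, ⟨⟨q⟩, fun v w => ?_⟩, fun v => ?_⟩
  · exact Relation.ReflTransGen.trans (hlink v (mem_univ v)).symm (hlink w (mem_univ w))
  · rw [hdeg]
    by_cases h : v = q <;> simp [h]

/-- A multidegree with enough chips on each nonempty set of vertices is a break divisor. -/
lemma isIBD_of_card_inE_lt [Nonempty V] {ends : E → V × V} {gen : V → ℕ} {A : Finset E}
    {x : V → ℤ} (hx : x ∈ Sdeg (gGamma E gen) A)
    (h : ∀ W : Finset V, W.Nonempty →
      ((A ∩ inE ends W).card : ℤ) + 1 ≤ ∑ v ∈ W, (x v - gen v) + W.card) :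
    isIBD ends gen A x := by
  obtain ⟨q⟩ := ‹Nonempty V›
  have : Nonempty V := ⟨q⟩
  have hnn : ∀ v, 0 ≤ x v - gen v + 1 - if v = q then 1 else 0 := by
    intro v
    have := h {v} (singleton_nonempty v)
    simp only [sum_singleton, card_singleton] at this
    split_ifs <;> omega
  choose D hD using fun v => Int.eq_ofNat_of_zero_le (hnn v)
  have hDsum : ∀ W : Finset V,
      ((∑ v ∈ W, D v : ℕ) : ℤ) = ∑ v ∈ W, (x v - gen v) + W.card - if q ∈ W then 1 else 0 := by
    intro W
    push_cast
    rw [← sum_congr rfl fun v _ => hD v]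
    simp [sum_sub_distrib, sum_add_distrib]
  have htot : ∑ v, D v = A.card := by
    have h1 := hDsum univ
    have h2 := card_sdiff_add_card_eq_card (subset_univ A)
    rw [card_univ] at h2
    simp only [Sdeg, Set.mem_ofPred_eq, gGamma, nG] at hx
    simp only [sum_sub_distrib, hx, mem_univ, if_true, card_univ] at h1
    omega
  obtain ⟨t, ht, htD⟩ := exists_orientation (ends := ends) (A := A) (D := D)
    (fun W hW => by
      have h1 := h W hW
      have h2 := hDsum W
      split_ifs at h2 <;> omega) htot
  obtain ⟨T, hTA, hT, hTdeg⟩ := exists_arborescence (q := q) ht (fun W hW hq => by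
    by_contra! hc
    have h1 := h W hW
    have h2 := hDsum W
    rw [if_neg hq, ← sum_congr rfl fun v _ => htD v,
      sum_card_fiberwise_eq_card_filter] at h2
    have h3 : (A.filter fun e => t e ∈ W).card ≤ (A ∩ inE ends W).card :=
      card_le_card fun e he => by
        rw [mem_filter] at he
        exact mem_inter.2 ⟨he.1, hc e he.1 he.2⟩
    omega)
  refine ⟨T, hTA, ⟨hT, ?_⟩, t, fun e he => ht e (mem_sdiff.1 he).1, funext fun v => ?_⟩
  · have h1 := card_eq_sum_card_fiberwise (f := t) (s := T) (t := univ) (by simp)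
    simp only [hTdeg] at h1
    have h2 : ∑ v : V, ((if v = q then 0 else 1) + if v = q then 1 else 0) = Fintype.card V := by
      rw [sum_congr rfl (g := fun _ => 1) fun v _ => by split_ifs <;> rfl]
      simp
    rw [sum_add_distrib, ← h1] at h2
    simpa using h2
  · have h1 : (A \ T).filter (fun e => t e = v)
        = A.filter (fun e => t e = v) \ T.filter (fun e => t e = v) := by
      ext e
      simp only [mem_filter, mem_sdiff]
      tauto
    have h2 := card_sdiff_add_card_eq_card (filter_subset_filter (fun e => t e = v) hTA)
    rw [← h1, hTdeg, htD] at h2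
    have h3 := hD v
    split_ifs at h2 h3 <;> omega

lemma sum_valence (ends : E → V × V) (W : Finset V) :
    ∑ v ∈ W, valence ends v = 2 * (inE ends W).card + (cutE ends W).card := by
  simp only [valence]
  rw [sum_comm, inE, cutE, card_filter, card_filter, mul_sum, ← sum_add_distrib]
  refine sum_congr rfl fun e _ => ?_
  rw [sum_add_distrib, sum_ite_eq, sum_ite_eq]
  by_cases h1 : (ends e).1 ∈ W <;> by_cases h2 : (ends e).2 ∈ W <;> simp [h1, h2]

lemma card_inE_add_card_cutE_add (ends : E → V × V) (A : Finset E) (W : Finset V) :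
    (A ∩ inE ends W).card + (A ∩ cutE ends W).card + (A ∩ inE ends Wᶜ).card = A.card := by
  rw [← filter_mem_eq_inter, ← filter_mem_eq_inter, ← filter_mem_eq_inter, card_filter,
    card_filter, card_filter, ← sum_add_distrib, ← sum_add_distrib, card_eq_sum_ones]
  refine sum_congr rfl fun e _ => ?_
  simp only [inE, cutE, mem_filter, mem_univ, true_and, mem_compl]
  by_cases h1 : (ends e).1 ∈ W <;> by_cases h2 : (ends e).2 ∈ W <;> simp [h1, h2]

lemma sum_phiIBD (ends : E → V × V) (gen : V → ℕ)
    (hbig : (2 : ℤ) ≤ gGamma E gen + (Fintype.card V : ℤ)) (W : Finset V) :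
    ∑ v ∈ W, phiIBD ends gen v =
      ∑ v ∈ W, (gen v : ℝ) + (inE ends W).card + (cutE ends W).card / 2 - W.card +
        (2 * ∑ v ∈ W, (gen v : ℝ) + 2 * (inE ends W).card + (cutE ends W).card) /
          (2 * (Fintype.card E + ∑ v, (gen v : ℝ))) := by
  have hM : (1 : ℝ) ≤ Fintype.card E + ∑ v, (gen v : ℝ) := by
    have : (1 : ℤ) ≤ Fintype.card E + ∑ v, (gen v : ℤ) := by
      rw [gGamma] at hbig
      linarith
    exact_mod_cast this
  have hN : (gGamma E gen : ℝ) + Fintype.card V = Fintype.card E + ∑ v, (gen v : ℝ) + 1 := by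
    rw [gGamma]
    push_cast
    ring
  have hval : ∑ v ∈ W, (valence ends v : ℝ) = 2 * (inE ends W).card + (cutE ends W).card := by
    exact_mod_cast sum_valence ends W
  simp only [phiIBD, sum_sub_distrib, ← mul_sum, sum_add_distrib, hval, hN]
  generalize (Fintype.card E : ℝ) + ∑ v, (gen v : ℝ) = M at hM
  have h1 : 2 * (M + 1) - 2 = 2 * M := by ring
  rw [h1]
  simp only [sum_const, nsmul_eq_mul, mul_one]
  field_simp
  ring

/-- The correction term in `φ_IBD` lies strictly between `0` and `1` on proper subsets. -/
lemma correction_mem_Ioo {ends : E → V × V} (gen : V → ℕ) (hconn : Conn ends (univ : Finset E))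
    {W : Finset V} (hW : W.Nonempty) (hW' : W ≠ univ) :
    (2 * ∑ v ∈ W, (gen v : ℝ) + 2 * (inE ends W).card + (cutE ends W).card) /
      (2 * (Fintype.card E + ∑ v, (gen v : ℝ))) ∈ Set.Ioo (0 : ℝ) 1 := by
  obtain ⟨e, -, he⟩ := hconn.exists_mem_cutE hW hW'
  have hc : (0 : ℝ) < (cutE ends W).card := by
    exact_mod_cast card_pos.2 ⟨e, he⟩
  have hg : (0 : ℝ) ≤ ∑ v ∈ W, (gen v : ℝ) := by positivity
  have hg' : ∑ v ∈ W, (gen v : ℝ) ≤ ∑ v, (gen v : ℝ) :=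
    sum_le_sum_of_subset_of_nonneg (subset_univ W) fun _ _ _ => by positivity
  have hE := card_inE_add_card_cutE_add ends univ W
  simp only [univ_inter, card_univ] at hE
  have hE' : ((inE ends W).card : ℝ) + (cutE ends W).card + (inE ends Wᶜ).card
      = Fintype.card E := by exact_mod_cast hE
  have hi : (0 : ℝ) ≤ (inE ends W).card := by positivity
  have hi' : (0 : ℝ) ≤ (inE ends Wᶜ).card := by positivity
  constructor
  · apply div_pos <;> linarith
  · rw [div_lt_one] <;> linarith

/-- Semistability for `φ_IBD` says that every nonempty set of vertices carries enough chips. -/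
lemma phiSemistable_phiIBD_iff {ends : E → V × V} {gen : V → ℕ}
    (hconn : Conn ends (univ : Finset E))
    (hbig : (2 : ℤ) ≤ gGamma E gen + (Fintype.card V : ℤ)) {A : Finset E} {x : V → ℤ}
    (hx : x ∈ Sdeg (gGamma E gen) A) :
    PhiSemistable ends (phiIBD ends gen) A x ↔ ∀ W : Finset V, W.Nonempty →
      ((A ∩ inE ends W).card : ℤ) + 1 ≤ ∑ v ∈ W, (x v - gen v) + W.card := by
  have hA : (univ \ A).card + A.card = Fintype.card E :=
    card_sdiff_add_card_eq_card (subset_univ A)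
  have hdeg : ∑ v, (x v - gen v) = (A.card : ℤ) - Fintype.card V + 1 := by
    simp only [Sdeg, Set.mem_ofPred_eq, gGamma, nG] at hx
    rw [sum_sub_distrib, hx]
    omega
  have hsplit : ∀ S : Finset E, (((univ \ A) ∩ S).card : ℝ) = S.card - (A ∩ S).card := by
    intro S
    have h : ((univ \ A) ∩ S).card + (A ∩ S).card = S.card := by
      rw [← card_union_of_disjoint, ← union_inter_distrib_right,
        sdiff_union_of_subset (subset_univ A), univ_inter]
      · exact (sdiff_disjoint).mono inter_subset_left inter_subset_left
    rw [← h]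
    push_cast
    ring
  have key : ∀ W : Finset V, W.Nonempty → W ≠ univ →
      (|(∑ v ∈ W, ((x v : ℝ) - phiIBD ends gen v)) + (((univ \ A) ∩ inE ends W).card : ℝ) +
        (((univ \ A) ∩ cutE ends W).card : ℝ) / 2| ≤ ((A ∩ cutE ends W).card : ℝ) / 2 ↔
      ((A ∩ inE ends W).card : ℤ) + 1 ≤ ∑ v ∈ W, (x v - gen v) + W.card ∧
      ∑ v ∈ W, (x v - gen v) + W.card ≤
        ((A ∩ inE ends W).card : ℤ) + (A ∩ cutE ends W).card) := by
    intro W hW hW'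
    obtain ⟨h0, h1⟩ := correction_mem_Ioo gen hconn hW hW'
    rw [sum_sub_distrib, sum_phiIBD ends gen hbig W, hsplit, hsplit, abs_le]
    generalize (2 * ∑ v ∈ W, (gen v : ℝ) + 2 * (inE ends W).card + (cutE ends W).card) /
      (2 * (Fintype.card E + ∑ v, (gen v : ℝ))) = θ at h0 h1 ⊢
    have hcast : ((∑ v ∈ W, (x v - gen v) : ℤ) : ℝ)
        = ∑ v ∈ W, (x v : ℝ) - ∑ v ∈ W, (gen v : ℝ) := by
      push_cast
      rw [sum_sub_distrib]
    generalize ∑ v ∈ W, (x v - gen v) = y at hcast ⊢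
    constructor
    · rintro ⟨hl, hu⟩
      have hl' : ((A ∩ inE ends W).card : ℝ) < (y : ℝ) + W.card := by linarith
      have hu' : (y : ℝ) + W.card < (A ∩ inE ends W).card + (A ∩ cutE ends W).card + 1 := by
        linarith
      exact ⟨Int.add_one_le_iff.2 (by exact_mod_cast hl'),
        Int.lt_add_one_iff.1 (by exact_mod_cast hu')⟩
    · rintro ⟨hl, hu⟩
      have hl' : ((A ∩ inE ends W).card : ℝ) + 1 ≤ (y : ℝ) + W.card := by exact_mod_cast hl
      have hu' : (y : ℝ) + W.card ≤ (A ∩ inE ends W).card + (A ∩ cutE ends W).card := by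
        exact_mod_cast hu
      constructor <;> linarith
  constructor
  · intro h W hW
    by_cases hu : W = univ
    · subst hu
      have := card_le_card (inter_subset_left (s₁ := A) (s₂ := inE ends univ))
      rw [hdeg, card_univ]
      omega
    · exact ((key W hW hu).1 (h W hW hu)).1
  · intro h W hW hu
    refine (key W hW hu).2 ⟨h W hW, ?_⟩
    have hc : Wᶜ.Nonempty := by
      rwa [nonempty_iff_ne_empty, Ne, compl_eq_empty_iff]
    have h1 := h Wᶜ hc
    have h2 := sum_add_sum_compl W fun v => x v - gen v
    have h3 := card_inE_add_card_cutE_add ends A W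
    have h4 := card_add_card_compl W
    omega

/-- If `g(Γ) + |Verts(Γ)| ≥ 2` then `φ_IBD ∈ V^{g(Γ)}(Γ)` and
`σ_IBD = stab_{Γ,φ_IBD}`: on every connected spanning subgraph `G`, the integral break
divisors for `G` are exactly the `φ_IBD`-semistable elements of `S^{g(Γ)}_Γ(G)`. -/
theorem statement12 (ends : E → V × V) (gen : V → ℕ)
    (hconn : Conn ends (Finset.univ : Finset E))
    (hbig : (2 : ℤ) ≤ gGamma E gen + (Fintype.card V : ℤ)) :
    (∑ v : V, phiIBD ends gen v = (gGamma E gen : ℝ)) ∧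
      ∀ A : Finset E, Conn ends A →
        {x : V → ℤ | isIBD ends gen A x} =
          {x : V → ℤ | x ∈ Sdeg (gGamma E gen) A ∧
            PhiSemistable ends (phiIBD ends gen) A x} := by
  constructor
  · rw [sum_phiIBD ends gen hbig]
    have hin : inE ends univ = univ := by simp [inE]
    have hcut : cutE ends univ = ∅ := by simp [cutE]
    have hM : (1 : ℝ) ≤ Fintype.card E + ∑ v, (gen v : ℝ) := by
      have : (1 : ℤ) ≤ Fintype.card E + ∑ v, (gen v : ℤ) := by
        rw [gGamma] at hbig
        linarith
      exact_mod_cast this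
    have hone : (2 * ∑ v, (gen v : ℝ) + 2 * Fintype.card E) /
        (2 * (Fintype.card E + ∑ v, (gen v : ℝ))) = 1 := by
      rw [div_eq_one_iff_eq (by linarith)]
      ring
    simp only [hin, hcut, card_univ, card_empty, Nat.cast_zero, add_zero, zero_div, hone, gGamma]
    push_cast
    ring
  · intro A hA
    have := hconn.1
    ext x
    constructor
    · intro hx
      exact ⟨hx.mem_Sdeg, (phiSemistable_phiIBD_iff hconn hbig hx.mem_Sdeg).2
        fun W hW => hx.card_inE_lt hW⟩
    · rintro ⟨hx, hs⟩
      exact isIBD_of_card_inE_lt hx ((phiSemistable_phiIBD_iff hconn hbig hx).1 hs)
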